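/- Let Γ be a Jordan curve and let D ⊆ ℂ be an open connected set containing Γ. Let u : D → ℝ be harmonic on D and let c > 0 be a constant such that: (i) u(z) = 0 for every z ∈ Γ; (ii) |u(z)| → c as z leaves every compact subset of D (for every ε > 0 there is a compact K ⊆ D with | |u(z)| − c | < ε for all z ∈ D∖K); (iii) the gradient ∇u(z) ≠ 0 for every z ∈ D. Then there exists a holomorphic function S on D (a Schwarz function of Γ) such that S(z) = conj(z) for every z ∈ Γ, the map z ↦ conj(S(z)) maps D onto D and is an involution (conj(S(conj(S(z)))) = z for all z ∈ D), and u(z) = −u(conj(S(z))) for every z ∈ D. -/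

import Mathlib

open MeasureTheory Filter Polynomial Set Metric

noncomputable section

/-- A Jordan curve: the range of an injective continuous map from the unit circle into `ℂ`. -/
def IsJordanCurve (C : Set ℂ) : Prop :=
  ∃ f : ℂ → ℂ, ContinuousOn f (sphere (0:ℂ) 1) ∧ InjOn f (sphere (0:ℂ) 1) ∧
    C = f '' sphere (0:ℂ) 1

/-- A Jordan domain: the bounded connected component of the complement of a Jordan curve. -/
def IsJordanDomain (D : Set ℂ) : Prop :=
  ∃ C : Set ℂ, IsJordanCurve C ∧ Bornology.IsBounded D ∧
    ∃ z ∈ Cᶜ, D = connectedComponentIn Cᶜ z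

/-- An archipelago: a finite family of Jordan domains with mutually disjoint closures. -/
def IsArchipelago {N : ℕ} (Gs : Fin N → Set ℂ) : Prop :=
  (∀ j, IsJordanDomain (Gs j)) ∧
  ∀ j k, j ≠ k → Disjoint (closure (Gs j)) (closure (Gs k))

/-- `P n` is the Bergman orthonormal polynomial of degree `n` for `G`, with positive real
leading coefficient `lam n`, and the family is orthonormal in `L²(G, dA)`. -/
def IsBergmanSystem (G : Set ℂ) (P : ℕ → Polynomial ℂ) (lam : ℕ → ℝ) : Prop :=
  (∀ n, (P n).natDegree = n) ∧
  (∀ n, 0 < lam n ∧ (P n).leadingCoeff = (lam n : ℂ)) ∧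
  ∀ n k, (∫ z in G, (P n).eval z * (starRingEnd ℂ) ((P k).eval z)) =
    if n = k then 1 else 0

/-- `u` is harmonic on the open set `D`: twice continuously differentiable with vanishing
Laplacian `∂²u/∂x² + ∂²u/∂y² = 0`. -/
def HarmonicOnSet (u : ℂ → ℝ) (D : Set ℂ) : Prop :=
  ContDiffOn ℝ 2 u D ∧
  ∀ z ∈ D,
    fderiv ℝ (fun w => fderiv ℝ u w 1) z 1 +
      fderiv ℝ (fun w => fderiv ℝ u w Complex.I) z Complex.I = 0

/-! ### Holomorphic flow lines -/

/-- `ψ` solves the complex differential equation `dψ/dt = 1 / f(ψ)` on `U`, with values in `D`. -/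
def IsComplexFlow (f : ℂ → ℂ) (D : Set ℂ) (ψ : ℂ → ℂ) (U : Set ℂ) : Prop :=
  ∀ t ∈ U, ψ t ∈ D ∧ HasDerivAt ψ (f (ψ t))⁻¹ t

/-- The open rectangle `(α, β) × (-δ, δ)`. -/
def openBox (α β δ : ℝ) : Set ℂ := Ioo α β ×ℂ Ioo (-δ) δ

theorem mem_openBox {α β δ : ℝ} {t : ℂ} :
    t ∈ openBox α β δ ↔ (α < t.re ∧ t.re < β) ∧ (-δ < t.im ∧ t.im < δ) := Iff.rfl

theorem isOpen_openBox (α β δ : ℝ) : IsOpen (openBox α β δ) := isOpen_Ioo.reProdIm isOpen_Ioo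

theorem convex_openBox (α β δ : ℝ) : Convex ℝ (openBox α β δ) :=
  ((convex_Ioo α β).linear_preimage Complex.reCLM.toLinearMap).inter
    ((convex_Ioo (-δ) δ).linear_preimage Complex.imCLM.toLinearMap)

theorem ofReal_mem_openBox {α β δ x : ℝ} (hδ : 0 < δ) (hx : x ∈ Ioo α β) :
    (x : ℂ) ∈ openBox α β δ := by
  simpa [mem_openBox, hδ] using hx

namespace IsComplexFlow

variable {f : ℂ → ℂ} {D U V : Set ℂ} {ψ ψ₁ ψ₂ : ℂ → ℂ}

theorem mono (h : IsComplexFlow f D ψ U) (hVU : V ⊆ U) : IsComplexFlow f D ψ V :=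
  fun t ht => h t (hVU ht)

theorem analyticOnNhd (h : IsComplexFlow f D ψ U) (hU : IsOpen U) : AnalyticOnNhd ℂ ψ U :=
  DifferentiableOn.analyticOnNhd
    (fun t ht => (h t ht).2.differentiableAt.differentiableWithinAt) hU

theorem comp_add_const (h : IsComplexFlow f D ψ U) (a : ℂ) (hV : ∀ t ∈ V, t + a ∈ U) :
    IsComplexFlow f D (fun t => ψ (t + a)) V :=
  fun t ht => ⟨(h _ (hV t ht)).1, (h _ (hV t ht)).2.comp_add_const t a⟩

theorem congr (h : IsComplexFlow f D ψ₁ U) (hU : IsOpen U) (he : EqOn ψ₂ ψ₁ U) :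
    IsComplexFlow f D ψ₂ U := by
  intro t ht
  rw [he ht]
  exact ⟨(h t ht).1, (h t ht).2.congr_of_eventuallyEq (he.eventuallyEq_of_mem (hU.mem_nhds ht))⟩

end IsComplexFlow

/-- A nonvanishing holomorphic function has, near each point, an injective primitive. -/
theorem exists_local_primitive_chart {f : ℂ → ℂ} {D : Set ℂ} (hD : IsOpen D)
    (hf : DifferentiableOn ℂ f D) (hf0 : ∀ z ∈ D, f z ≠ 0) {p : ℂ} (hp : p ∈ D) :
    ∃ e : OpenPartialHomeomorph ℂ ℂ, p ∈ e.source ∧ e.source ⊆ D ∧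
      ∀ z ∈ e.source, HasDerivAt e (f z) z := by
  obtain ⟨ρ, hρ, hball⟩ := Metric.isOpen_iff.1 hD p hp
  obtain ⟨F, hF⟩ := (hf.mono hball).isExactOn_ball
  have hFan : AnalyticAt ℂ F p :=
    DifferentiableOn.analyticAt (s := ball p ρ)
      (fun z hz => (hF z hz).differentiableAt.differentiableWithinAt) (ball_mem_nhds p hρ)
  have hs : HasStrictDerivAt F (f p) p := by
    have := hFan.hasStrictDerivAt
    rwa [(hF p (mem_ball_self hρ)).deriv] at this
  have hs' := hs.hasStrictFDerivAt_equiv (hf0 p hp)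
  refine ⟨(hs'.toOpenPartialHomeomorph F).restrOpen (ball p ρ) isOpen_ball,
    ⟨hs'.mem_toOpenPartialHomeomorph_source, mem_ball_self hρ⟩,
    fun z hz => hball hz.2, fun z hz => hF z hz.2⟩

theorem IsComplexFlow.eventually_eq_symm {f : ℂ → ℂ} {D U : Set ℂ} {ψ : ℂ → ℂ}
    (h : IsComplexFlow f D ψ U) (hU : IsOpen U) (hf0 : ∀ z ∈ D, f z ≠ 0)
    {e : OpenPartialHomeomorph ℂ ℂ} (he : ∀ z ∈ e.source, HasDerivAt e (f z) z)
    {t₀ : ℂ} (ht₀ : t₀ ∈ U) (hs : ψ t₀ ∈ e.source) :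
    ∀ᶠ t in nhds t₀, ψ t = e.symm (e (ψ t₀) + (t - t₀)) := by
  have hev : ∀ᶠ t in nhds t₀, t ∈ U ∧ ψ t ∈ e.source :=
    (hU.eventually_mem ht₀).and
      ((h t₀ ht₀).2.continuousAt.eventually (e.open_source.mem_nhds hs))
  obtain ⟨ρ, hρ, hball⟩ := Metric.eventually_nhds_iff_ball.1 hev
  have hder : ∀ t ∈ ball t₀ ρ, HasDerivAt (fun t => e (ψ t) - t) 0 t := by
    intro t ht
    obtain ⟨htU, hts⟩ := hball t ht
    have := ((he _ hts).comp t (h t htU).2).sub (hasDerivAt_id t)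
    rwa [mul_inv_cancel₀ (hf0 _ (h t htU).1), sub_self] at this
  filter_upwards [ball_mem_nhds t₀ hρ] with t ht
  have hconst : e (ψ t) - t = e (ψ t₀) - t₀ :=
    isOpen_ball.is_const_of_deriv_eq_zero (convex_ball t₀ ρ).isPreconnected
      (fun s hs => (hder s hs).differentiableAt.differentiableWithinAt)
      (fun s hs => (hder s hs).deriv) ht (mem_ball_self hρ)
  have : e (ψ t₀) + (t - t₀) = e (ψ t) := by linear_combination -hconst
  rw [this, e.left_inv (hball t ht).2]

/-- Uniqueness of complex flows on connected sets. -/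
theorem IsComplexFlow.eqOn {f : ℂ → ℂ} {D U : Set ℂ} {ψ₁ ψ₂ : ℂ → ℂ}
    (hD : IsOpen D) (hf : DifferentiableOn ℂ f D) (hf0 : ∀ z ∈ D, f z ≠ 0)
    (h₁ : IsComplexFlow f D ψ₁ U) (h₂ : IsComplexFlow f D ψ₂ U) (hU : IsOpen U)
    (hUc : IsPreconnected U) {t₀ : ℂ} (ht₀ : t₀ ∈ U) (heq : ψ₁ t₀ = ψ₂ t₀) :
    EqOn ψ₁ ψ₂ U := by
  obtain ⟨e, hpe, -, he⟩ := exists_local_primitive_chart hD hf hf0 (h₁ t₀ ht₀).1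
  refine (h₁.analyticOnNhd hU).eqOn_of_preconnected_of_eventuallyEq (h₂.analyticOnNhd hU)
    hUc ht₀ ?_
  filter_upwards [h₁.eventually_eq_symm hU hf0 he ht₀ hpe,
    h₂.eventually_eq_symm hU hf0 he ht₀ (heq ▸ hpe)] with t ha hb
  rw [ha, hb, heq]

/-- Complex flows starting in a compact set exist on a box of uniform size. -/
theorem exists_complexFlow_of_isCompact {f : ℂ → ℂ} {D K : Set ℂ} (hD : IsOpen D)
    (hf : DifferentiableOn ℂ f D) (hf0 : ∀ z ∈ D, f z ≠ 0) (hK : IsCompact K) (hKD : K ⊆ D) :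
    ∃ r : ℝ, 0 < r ∧ ∀ q ∈ K, ∃ ψ, IsComplexFlow f D ψ (openBox (-r) r r) ∧ ψ 0 = q := by
  have hbox : ∀ {r s : ℝ}, r ≤ s → openBox (-r) r r ⊆ openBox (-s) s s := fun hrs t ht => by
    simp only [mem_openBox] at ht ⊢
    exact ⟨⟨by linarith, by linarith⟩, by linarith, by linarith⟩
  refine hK.induction_on (p := fun A => ∃ r : ℝ, 0 < r ∧ ∀ q ∈ A,
    ∃ ψ, IsComplexFlow f D ψ (openBox (-r) r r) ∧ ψ 0 = q) ⟨1, one_pos, by simp⟩ ?_ ?_ ?_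
  · rintro A B hAB ⟨r, hr, h⟩
    exact ⟨r, hr, fun q hq => h q (hAB hq)⟩
  · rintro A B ⟨r, hr, h⟩ ⟨s, hs, h'⟩
    refine ⟨min r s, lt_min hr hs, ?_⟩
    rintro q (hq | hq)
    · obtain ⟨ψ, hψ, h0⟩ := h q hq
      exact ⟨ψ, hψ.mono (hbox (min_le_left r s)), h0⟩
    · obtain ⟨ψ, hψ, h0⟩ := h' q hq
      exact ⟨ψ, hψ.mono (hbox (min_le_right r s)), h0⟩
  · intro p hp
    obtain ⟨e, hpe, heD, he⟩ := exists_local_primitive_chart hD hf hf0 (hKD hp)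
    obtain ⟨ρ, hρ, hball⟩ := Metric.isOpen_iff.1 e.open_target _ (e.map_source hpe)
    refine ⟨e.source ∩ e ⁻¹' ball (e p) (ρ / 2), mem_nhdsWithin_of_mem_nhds
      (Filter.inter_mem (e.open_source.mem_nhds hpe)
        ((e.continuousAt hpe).preimage_mem_nhds (ball_mem_nhds _ (half_pos hρ)))),
      ρ / 4, by positivity, ?_⟩
    rintro q ⟨hqe, hq⟩
    refine ⟨fun t => e.symm (t + e q), fun t ht => ?_, by simp [e.left_inv hqe]⟩
    have htar : t + e q ∈ e.target := by
      apply hball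
      rw [mem_openBox] at ht
      have h1 : ‖t‖ < ρ / 2 := by
        have := Complex.norm_le_abs_re_add_abs_im t
        have := abs_lt.2 ht.1
        have := abs_lt.2 ht.2
        linarith
      rw [mem_preimage, mem_ball, dist_eq_norm] at hq
      rw [mem_ball, dist_eq_norm]
      calc ‖t + e q - e p‖ = ‖t + (e q - e p)‖ := by ring_nf
        _ ≤ ‖t‖ + ‖e q - e p‖ := norm_add_le _ _
        _ < ρ := by linarith
    have hsrc := e.map_target htar
    exact ⟨heD hsrc, (e.hasDerivAt_symm htar (hf0 _ (heD hsrc)) (he _ hsrc)).comp_add_const t _⟩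

/-- Two complex flows on overlapping boxes of equal height that agree at a real point glue. -/
theorem IsComplexFlow.exists_glue {f : ℂ → ℂ} {D : Set ℂ} {ψ₁ ψ₂ : ℂ → ℂ} {α β α' β' δ x : ℝ}
    (hD : IsOpen D) (hf : DifferentiableOn ℂ f D) (hf0 : ∀ z ∈ D, f z ≠ 0)
    (h₁ : IsComplexFlow f D ψ₁ (openBox α β δ)) (h₂ : IsComplexFlow f D ψ₂ (openBox α' β' δ))
    (hδ : 0 < δ) (hx : x ∈ Ioo α β) (hx' : x ∈ Ioo α' β') (heq : ψ₁ x = ψ₂ x) :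
    ∃ ψ, IsComplexFlow f D ψ (openBox (min α α') (max β β') δ) ∧
      EqOn ψ ψ₁ (openBox α β δ) := by
  classical
  have hE : EqOn ψ₁ ψ₂ (openBox α β δ ∩ openBox α' β' δ) :=
    (h₁.mono inter_subset_left).eqOn hD hf hf0 (h₂.mono inter_subset_right)
      ((isOpen_openBox _ _ _).inter (isOpen_openBox _ _ _))
      ((convex_openBox _ _ _).inter (convex_openBox _ _ _)).isPreconnected
      ⟨ofReal_mem_openBox hδ hx, ofReal_mem_openBox hδ hx'⟩ heq
  have hp₁ : EqOn ((openBox α β δ).piecewise ψ₁ ψ₂) ψ₁ (openBox α β δ) :=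
    piecewise_eqOn _ _ _
  have hp₂ : EqOn ((openBox α β δ).piecewise ψ₁ ψ₂) ψ₂ (openBox α' β' δ) := by
    intro t ht
    by_cases h : t ∈ openBox α β δ
    · rw [piecewise_eq_of_mem _ _ _ h, hE ⟨h, ht⟩]
    · rw [piecewise_eq_of_notMem _ _ _ h]
  refine ⟨_, fun t ht => ?_, hp₁⟩
  have hcases : t ∈ openBox α β δ ∨ t ∈ openBox α' β' δ := by
    simp only [mem_openBox, mem_Ioo, min_lt_iff, lt_max_iff] at ht hx hx' ⊢
    grind
  rcases hcases with h | h
  · exact h₁.congr (isOpen_openBox _ _ _) hp₁ t h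
  · exact h₂.congr (isOpen_openBox _ _ _) hp₂ t h

/-- If `∇u = conj f`, the flow of `1 / f` increases `u` at unit speed in the real direction. -/
theorem IsComplexFlow.apply_eq_re {f : ℂ → ℂ} {D U : Set ℂ} {ψ : ℂ → ℂ} {u : ℂ → ℝ}
    (hf0 : ∀ z ∈ D, f z ≠ 0)
    (hu : ∀ z ∈ D, HasFDerivAt u (Complex.reCLM ∘L ContinuousLinearMap.mul ℝ ℂ (f z)) z)
    (h : IsComplexFlow f D ψ U) (hU : IsOpen U) (hUc : IsPreconnected U) {t₀ : ℂ} (ht₀ : t₀ ∈ U)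
    (h₀ : u (ψ t₀) = t₀.re) {t : ℂ} (ht : t ∈ U) : u (ψ t) = t.re := by
  have hder : ∀ s ∈ U, HasFDerivAt (fun s => u (ψ s) - s.re) (0 : ℂ →L[ℝ] ℝ) s := by
    intro s hs
    have h1 := (hu _ (h s hs).1).comp s ((h s hs).2.hasFDerivAt.restrictScalars ℝ)
    have h2 := h1.sub (Complex.reCLM.hasFDerivAt (x := s))
    refine h2.congr_fderiv ?_
    ext w
    simp [mul_inv_cancel₀ (hf0 _ (h s hs).1), mul_left_comm (f (ψ s))]
  have := hU.is_const_of_fderiv_eq_zero (𝕜 := ℝ) hUc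
    (fun s hs => (hder s hs).differentiableAt.differentiableWithinAt)
    (fun s hs => (hder s hs).fderiv) ht ht₀
  linarith

/-- If the sublevel set `|u| ≤ a` lies in a compact subset of `D`, flow lines through its points
extend over the whole range `(-a, a)` of values of `u`. -/
theorem exists_complexFlow_openBox {f : ℂ → ℂ} {D K : Set ℂ} {u : ℂ → ℝ} {a : ℝ}
    (hD : IsOpen D) (hf : DifferentiableOn ℂ f D) (hf0 : ∀ z ∈ D, f z ≠ 0)
    (hu : ∀ z ∈ D, HasFDerivAt u (Complex.reCLM ∘L ContinuousLinearMap.mul ℝ ℂ (f z)) z)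
    (hK : IsCompact K) (hKD : K ⊆ D) (hKa : ∀ z ∈ D, |u z| ≤ a → z ∈ K)
    {z : ℂ} (hz : z ∈ D) (hza : |u z| < a) :
    ∃ δ : ℝ, 0 < δ ∧ ∃ ψ, IsComplexFlow f D ψ (openBox (-a) a δ) ∧ ψ (u z) = z := by
  obtain ⟨r, hr, hloc⟩ := exists_complexFlow_of_isCompact hD hf hf0 hK hKD
  have hshift : ∀ q ∈ K, ∀ y : ℝ, ∃ ψ, IsComplexFlow f D ψ (openBox (y - r) (y + r) r) ∧
      ψ y = q := by
    intro q hq y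
    obtain ⟨ψ, hψ, h0⟩ := hloc q hq
    refine ⟨_, hψ.comp_add_const (-(y : ℂ)) fun t ht => ?_, by simp [h0]⟩
    simp only [mem_openBox, Complex.add_re, Complex.add_im, Complex.neg_re, Complex.neg_im,
      Complex.ofReal_re, Complex.ofReal_im] at ht ⊢
    exact ⟨⟨by linarith, by linarith⟩, by linarith, by linarith⟩
  have hextend : ∀ α β y : ℝ, u z ∈ Ioo α β → y ∈ Ioo α β → |y| ≤ a →
      (∃ ψ, IsComplexFlow f D ψ (openBox α β r) ∧ ψ (u z) = z) →
      ∃ ψ, IsComplexFlow f D ψ (openBox (min α (y - r)) (max β (y + r)) r) ∧ ψ (u z) = z := by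
    rintro α β y hx hy hya ⟨ψ, hψ, hψz⟩
    have hmem := ofReal_mem_openBox hr hy
    have huy : u (ψ y) = y := by
      simpa using hψ.apply_eq_re hf0 hu (isOpen_openBox _ _ _)
        (convex_openBox _ _ _).isPreconnected (ofReal_mem_openBox hr hx) (by simp [hψz]) hmem
    obtain ⟨φ, hφ, hφy⟩ := hshift (ψ y) (hKa _ (hψ _ hmem).1 (by rwa [huy])) y
    obtain ⟨χ, hχ, hχe⟩ := hψ.exists_glue hD hf hf0 hφ hr hy
      ⟨by linarith, by linarith⟩ hφy.symm
    exact ⟨χ, hχ, by rw [hχe (ofReal_mem_openBox hr hx), hψz]⟩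
  have hza' := abs_lt.1 hza
  have hgrow : ∀ n : ℕ, ∃ α β : ℝ, u z ∈ Ioo α β ∧ (α ≤ -a ∨ α ≤ u z - n * (r / 2)) ∧
      (a ≤ β ∨ u z + n * (r / 2) ≤ β) ∧
      ∃ ψ, IsComplexFlow f D ψ (openBox α β r) ∧ ψ (u z) = z := by
    intro n
    induction n with
    | zero =>
      exact ⟨u z - r, u z + r, ⟨by linarith, by linarith⟩, Or.inr (by simp; linarith),
        Or.inr (by simp; linarith), hshift z (hKa z hz hza.le) (u z)⟩
    | succ n ih =>
      obtain ⟨α, β, hx, hα, hβ, hψ⟩ := ih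
      have hright : ∃ β', u z < β' ∧ (a ≤ β' ∨ u z + (n + 1 : ℕ) * (r / 2) ≤ β') ∧
          ∃ ψ, IsComplexFlow f D ψ (openBox α β' r) ∧ ψ (u z) = z := by
        rcases le_or_gt a β with hle | hlt
        · exact ⟨β, hx.2, Or.inl hle, hψ⟩
        · have hy : max (u z) (β - r / 4) ∈ Ioo α β :=
            ⟨lt_max_of_lt_left hx.1, max_lt hx.2 (by linarith)⟩
          have h1 := le_max_left (u z) (β - r / 4)
          have h2 := le_max_right (u z) (β - r / 4)
          obtain ⟨ψ, hflow, hval⟩ := hextend α β _ hx hy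
            (abs_le.2 ⟨by linarith, by linarith [hy.2]⟩) hψ
          refine ⟨max β (max (u z) (β - r / 4) + r), lt_max_of_lt_left hx.2, Or.inr ?_, ψ,
            hflow.mono fun t ht => ⟨⟨(min_le_left _ _).trans_lt ht.1.1, ht.1.2⟩, ht.2⟩, hval⟩
          refine le_max_of_le_right ?_
          push_cast
          rcases hβ with h | h <;> linarith
      obtain ⟨β', hxβ', hβ', hψ'⟩ := hright
      have hx' : u z ∈ Ioo α β' := ⟨hx.1, hxβ'⟩
      rcases le_or_gt α (-a) with hle | hlt
      · exact ⟨α, β', hx', Or.inl hle, hβ', hψ'⟩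
      · have hy : min (u z) (α + r / 4) ∈ Ioo α β' :=
          ⟨lt_min hx.1 (by linarith), min_lt_of_left_lt hxβ'⟩
        have h1 := min_le_left (u z) (α + r / 4)
        have h2 := min_le_right (u z) (α + r / 4)
        obtain ⟨ψ, hflow, hval⟩ := hextend α β' _ hx' hy
          (abs_le.2 ⟨by linarith [hy.1], by linarith⟩) hψ'
        refine ⟨min α (min (u z) (α + r / 4) - r), β', ⟨min_lt_of_left_lt hx.1, hxβ'⟩,
          Or.inr ?_, hβ', ψ,
          hflow.mono fun t ht => ⟨⟨ht.1.1, ht.1.2.trans_le (le_max_left _ _)⟩, ht.2⟩, hval⟩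
        refine min_le_of_right_le ?_
        push_cast
        rcases hα with h | h <;> linarith
  obtain ⟨n, hn⟩ := exists_nat_gt (2 * a / (r / 2))
  rw [div_lt_iff₀ (half_pos hr)] at hn
  obtain ⟨α, β, -, hα, hβ, ψ, hψ, hval⟩ := hgrow n
  have hα' : α ≤ -a := by rcases hα with h | h <;> linarith
  have hβ' : a ≤ β := by rcases hβ with h | h <;> linarith
  exact ⟨r, hr, ψ, hψ.mono fun t ht =>
    ⟨⟨hα'.trans_lt ht.1.1, ht.1.2.trans_le hβ'⟩, ht.2⟩, hval⟩

/-! ### Harmonic functions without critical points -/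

/-- The complex partial derivative `u_x - i u_y` of a real-valued function. -/
def complexPartial (u : ℂ → ℝ) (z : ℂ) : ℂ := fderiv ℝ u z 1 - Complex.I * fderiv ℝ u z Complex.I

theorem fderiv_eq_re_mul_complexPartial (u : ℂ → ℝ) (z : ℂ) :
    fderiv ℝ u z = Complex.reCLM ∘L ContinuousLinearMap.mul ℝ ℂ (complexPartial u z) := by
  ext w
  have hw : w = w.re • (1 : ℂ) + w.im • Complex.I := by simp [Complex.re_add_im]
  conv_lhs => rw [hw, map_add, map_smul, map_smul]
  simp [complexPartial, mul_comm]

theorem HarmonicOnSet.differentiableOn_complexPartial {u : ℂ → ℝ} {D : Set ℂ} (hD : IsOpen D)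
    (hu : HarmonicOnSet u D) : DifferentiableOn ℂ (complexPartial u) D := by
  have hlap : ∀ z ∈ D, Laplacian.laplacian u z = 0 := by
    intro z hz
    have hd : DifferentiableAt ℝ (fderiv ℝ u) z :=
      ((hu.1.contDiffAt (hD.mem_nhds hz)).fderiv_right (m := 1) (by norm_num)).differentiableAt
        (by norm_num)
    have happly : ∀ v : ℂ, fderiv ℝ (fun w => fderiv ℝ u w v) z v =
        iteratedFDeriv ℝ 2 u z ![v, v] := by
      intro v
      rw [iteratedFDeriv_two_apply, fderiv_clm_apply hd (differentiableAt_const v)]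
      simp
    rw [InnerProductSpace.laplacian_eq_iteratedFDeriv_complexPlane]
    simp only [← happly]
    exact hu.2 z hz
  intro z hz
  refine (HarmonicAt.differentiableAt_complex_partial
    ⟨hu.1.contDiffAt (hD.mem_nhds hz), ?_⟩).differentiableWithinAt
  filter_upwards [hD.mem_nhds hz] with w hw using hlap w hw

theorem not_isLocalMax_abs_of_fderiv_ne_zero {u : ℂ → ℝ} {z : ℂ} (h : fderiv ℝ u z ≠ 0) :
    ¬ IsLocalMax (fun w => |u w|) z := by
  intro hmax
  apply h
  rcases le_total 0 (u z) with h0 | h0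
  · refine IsLocalMax.fderiv_eq_zero ?_
    filter_upwards [hmax] with w hw
    rw [abs_of_nonneg h0] at hw
    exact (le_abs_self _).trans hw
  · refine IsLocalMin.fderiv_eq_zero ?_
    filter_upwards [hmax] with w hw
    rw [abs_of_nonpos h0] at hw
    linarith [neg_abs_le (u w)]

theorem abs_lt_of_abs_tendsto_boundary {u : ℂ → ℝ} {D : Set ℂ} {c : ℝ} (hD : IsOpen D)
    (hu : ContinuousOn u D)
    (hbd : ∀ ε : ℝ, 0 < ε → ∃ K : Set ℂ, K ⊆ D ∧ IsCompact K ∧ ∀ z ∈ D \ K, |(|u z|) - c| < ε)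
    (hgrad : ∀ z ∈ D, fderiv ℝ u z ≠ 0) {z : ℂ} (hz : z ∈ D) : |u z| < c := by
  by_contra! hcz
  obtain ⟨w, hw, hwD⟩ : ∃ w, |u z| < |u w| ∧ w ∈ D := by
    have hfreq : ∃ᶠ w in nhds z, ¬ |u w| ≤ |u z| :=
      Filter.not_eventually.1 (not_isLocalMax_abs_of_fderiv_ne_zero (hgrad z hz))
    obtain ⟨w, hw, hwD⟩ := (hfreq.and_eventually (hD.mem_nhds hz)).exists
    exact ⟨w, not_le.1 hw, hwD⟩
  obtain ⟨K, hKD, hK, hout⟩ := hbd (|u w| - c) (by linarith)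
  have hout' : ∀ y ∈ D, y ∉ K → |u y| < |u w| := fun y hy hyK => by
    linarith [(abs_lt.1 (hout y ⟨hy, hyK⟩)).2]
  have hwK : w ∈ K := by
    by_contra h
    exact lt_irrefl _ (hout' w hwD h)
  obtain ⟨m, hmK, hm⟩ := hK.exists_isMaxOn ⟨w, hwK⟩ (hu.mono hKD).abs
  refine not_isLocalMax_abs_of_fderiv_ne_zero (hgrad m (hKD hmK)) ?_
  filter_upwards [hD.mem_nhds (hKD hmK)] with y hy
  by_cases hyK : y ∈ K
  · exact hm hyK
  · exact (hout' y hy hyK).le.trans (hm hwK)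

/-! ### The reflection -/

/-- If every flow line of `1 / f` through a point of `D` is defined on a symmetric range of values
of `u`, then moving along it from `u = x` to `u = -x` is an antiholomorphic involution of `D`. -/
theorem exists_schwarz_reflection {f : ℂ → ℂ} {D : Set ℂ} {u : ℂ → ℝ}
    (hD : IsOpen D) (hf : DifferentiableOn ℂ f D) (hf0 : ∀ z ∈ D, f z ≠ 0)
    (hu : ∀ z ∈ D, HasFDerivAt u (Complex.reCLM ∘L ContinuousLinearMap.mul ℝ ℂ (f z)) z)
    (hflow : ∀ z ∈ D, ∃ a δ : ℝ, |u z| < a ∧ 0 < δ ∧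
      ∃ ψ, IsComplexFlow f D ψ (openBox (-a) a δ) ∧ ψ (u z) = z) :
    ∃ R : ℂ → ℂ, DifferentiableOn ℂ (fun z => (starRingEnd ℂ) (R z)) D ∧
      (∀ z ∈ D, R z ∈ D) ∧ (∀ z ∈ D, R (R z) = z) ∧ (∀ z ∈ D, u (R z) = -u z) ∧
      ∀ z ∈ D, u z = 0 → R z = z := by
  choose! a δ ha hδ ψ hψ hψz using hflow
  have hmem : ∀ {x a δ : ℝ}, |x| < a → 0 < δ → (x : ℂ) ∈ openBox (-a) a δ :=
    fun hx hd => ofReal_mem_openBox hd (abs_lt.1 hx)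
  -- Any flow line through `z` computes the reflection of `z`.
  have huniq : ∀ z ∈ D, ∀ (b η : ℝ) (φ : ℂ → ℂ), |u z| < b → 0 < η →
      IsComplexFlow f D φ (openBox (-b) b η) → φ (u z) = z →
      ψ z ((-u z : ℝ) : ℂ) = φ ((-u z : ℝ) : ℂ) := by
    intro z hz b η φ hb hη hφ hφz
    have hneg : |-u z| = |u z| := abs_neg _
    exact ((hψ z hz).mono inter_subset_left).eqOn hD hf hf0 (hφ.mono inter_subset_right)
      ((isOpen_openBox _ _ _).inter (isOpen_openBox _ _ _))
      ((convex_openBox _ _ _).inter (convex_openBox _ _ _)).isPreconnected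
      ⟨hmem (ha z hz) (hδ z hz), hmem hb hη⟩ ((hψz z hz).trans hφz.symm)
      ⟨hmem (hneg ▸ ha z hz) (hδ z hz), hmem (hneg ▸ hb) hη⟩
  have hre : ∀ z ∈ D, ∀ t ∈ openBox (-a z) (a z) (δ z), u (ψ z t) = t.re := by
    intro z hz t ht
    exact (hψ z hz).apply_eq_re hf0 hu (isOpen_openBox _ _ _)
      (convex_openBox _ _ _).isPreconnected (hmem (ha z hz) (hδ z hz)) (by simp [hψz z hz]) ht
  have hnegmem : ∀ z ∈ D, ((-u z : ℝ) : ℂ) ∈ openBox (-a z) (a z) (δ z) :=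
    fun z hz => hmem ((abs_neg (u z)).symm ▸ ha z hz) (hδ z hz)
  have hRD : ∀ z ∈ D, ψ z ((-u z : ℝ) : ℂ) ∈ D := fun z hz => (hψ z hz _ (hnegmem z hz)).1
  have huR : ∀ z ∈ D, u (ψ z ((-u z : ℝ) : ℂ)) = -u z := fun z hz => by
    simpa using hre z hz _ (hnegmem z hz)
  refine ⟨fun z => ψ z ((-u z : ℝ) : ℂ), fun z hz => ?_, hRD, fun z hz => ?_, huR,
    fun z hz h0 => ?_⟩
  · refine DifferentiableAt.differentiableWithinAt ?_
    have ht₀ := hmem (ha z hz) (hδ z hz)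
    have hne : (f z)⁻¹ ≠ 0 := inv_ne_zero (hf0 z hz)
    have hs : HasStrictDerivAt (ψ z) (f z)⁻¹ (u z : ℂ) := by
      have := ((hψ z hz).analyticOnNhd (isOpen_openBox _ _ _) _ ht₀).hasStrictDerivAt
      rwa [(hψ z hz _ ht₀).2.deriv, hψz z hz] at this
    set h := hs.localInverse _ _ _ hne
    have hdiff : DifferentiableAt ℂ h z := by
      have := (hs.to_localInverse hne).hasDerivAt.differentiableAt
      rwa [hψz z hz] at this
    have hhz : h z = u z := by
      have := (hs.eventually_left_inverse hne).self_of_nhds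
      rwa [hψz z hz] at this
    have hright : ∀ᶠ w in nhds z, ψ z (h w) = w := by
      have := hs.eventually_right_inverse hne
      rwa [hψz z hz] at this
    have hbox : ∀ᶠ w in nhds z, h w ∈ openBox (-a z) (a z) (δ z) :=
      hdiff.continuousAt.eventually ((isOpen_openBox _ _ _).mem_nhds (hhz ▸ ht₀))
    have heq : (fun w => (starRingEnd ℂ) (ψ w ((-u w : ℝ) : ℂ))) =ᶠ[nhds z]
        fun w => (starRingEnd ℂ) (ψ z ((starRingEnd ℂ) (-h w))) := by
      filter_upwards [hright, hbox, hD.mem_nhds hz] with w hw hwbox hwD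
      have huw : u w = (h w).re := by rw [← hre z hz _ hwbox, hw]
      rw [mem_openBox] at hwbox
      have him : |(h w).im| < δ z := abs_lt.2 hwbox.2
      have hshift : IsComplexFlow f D (fun t => ψ z (t + (h w).im * Complex.I))
          (openBox (-a z) (a z) (δ z - |(h w).im|)) := by
        refine (hψ z hz).comp_add_const _ fun t ht => ?_
        simp only [mem_openBox, Complex.add_re, Complex.add_im, Complex.mul_re, Complex.mul_im,
          Complex.ofReal_re, Complex.ofReal_im, Complex.I_re, Complex.I_im] at ht ⊢
        have := neg_abs_le (h w).im
        have := le_abs_self (h w).im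
        exact ⟨⟨by linarith, by linarith⟩, by linarith, by linarith⟩
      rw [huniq w hwD _ _ _ (huw ▸ abs_lt.2 hwbox.1) (sub_pos.2 him) hshift
        (by rw [huw, Complex.re_add_im, hw])]
      congr 2
      apply Complex.ext <;> simp [huw]
    refine DifferentiableAt.congr_of_eventuallyEq ?_ heq
    have hψd : DifferentiableAt ℂ (ψ z) ((-u z : ℝ) : ℂ) :=
      (hψ z hz _ (hnegmem z hz)).2.differentiableAt
    have hconj := hψd.conj_conj
    refine DifferentiableAt.comp z (g := (starRingEnd ℂ) ∘ ψ z ∘ (starRingEnd ℂ)) ?_ hdiff.neg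
    simpa [hhz] using hconj
  · have := huniq _ (hRD z hz) (a z) (δ z) (ψ z) (by rw [huR z hz, abs_neg]; exact ha z hz)
      (hδ z hz) (hψ z hz) (by rw [huR z hz])
    simp only at this ⊢
    rw [this, huR z hz, neg_neg, hψz z hz]
  · have := hψz z hz
    rw [h0] at this
    simpa [h0] using this

/-- Existence of a Schwarz function: if `u` is harmonic on a domain `D ⊇ Γ`, vanishes on the
Jordan curve `Γ`, satisfies `|u| → c > 0` towards `∂D` and `∇u ≠ 0` on `D`, then `Γ` has a
Schwarz function `S` holomorphic on all of `D`, the reflection `z ↦ conj(S(z))` maps `D` onto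
itself and is an involution, and `u(z) = −u(conj(S(z)))` on `D`. -/
theorem stmt16 (Γ : Set ℂ) (hΓ : IsJordanCurve Γ)
    (D : Set ℂ) (hD : IsOpen D) (hDconn : IsConnected D) (hΓD : Γ ⊆ D)
    (u : ℂ → ℝ) (hu : HarmonicOnSet u D) (c : ℝ) (hc : 0 < c)
    (huΓ : ∀ z ∈ Γ, u z = 0)
    (hbd : ∀ ε : ℝ, 0 < ε → ∃ K : Set ℂ, K ⊆ D ∧ IsCompact K ∧
      ∀ z ∈ D \ K, |(|u z|) - c| < ε)
    (hgrad : ∀ z ∈ D, fderiv ℝ u z ≠ 0) :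
    ∃ S : ℂ → ℂ,
      DifferentiableOn ℂ S D ∧
      (∀ z ∈ Γ, S z = (starRingEnd ℂ) z) ∧
      MapsTo (fun z => (starRingEnd ℂ) (S z)) D D ∧
      SurjOn (fun z => (starRingEnd ℂ) (S z)) D D ∧
      (∀ z ∈ D, (starRingEnd ℂ) (S ((starRingEnd ℂ) (S z))) = z) ∧
      ∀ z ∈ D, u z = -u ((starRingEnd ℂ) (S z)) := by
  have huc : ContinuousOn u D := hu.1.continuousOn
  have hudiff : ∀ z ∈ D, HasFDerivAt u
      (Complex.reCLM ∘L ContinuousLinearMap.mul ℝ ℂ (complexPartial u z)) z := fun z hz => by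
    rw [← fderiv_eq_re_mul_complexPartial]
    exact ((hu.1.contDiffAt (hD.mem_nhds hz)).differentiableAt (by norm_num)).hasFDerivAt
  have hf := hu.differentiableOn_complexPartial hD
  have hf0 : ∀ z ∈ D, complexPartial u z ≠ 0 := fun z hz h0 => hgrad z hz (by
    rw [fderiv_eq_re_mul_complexPartial, h0]
    simp)
  obtain ⟨R, hRdiff, hRD, hRR, huR, hR0⟩ := exists_schwarz_reflection hD hf hf0 hudiff (by
    intro z hz
    obtain ⟨a, hza, hac⟩ := exists_between (abs_lt_of_abs_tendsto_boundary hD huc hbd hgrad hz)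
    obtain ⟨K, hKD, hK, hout⟩ := hbd (c - a) (by linarith)
    have hKa : ∀ w ∈ D, |u w| ≤ a → w ∈ K := fun w hw hwa => by
      by_contra hwK
      linarith [(abs_lt.1 (hout w ⟨hw, hwK⟩)).1]
    obtain ⟨δ, hδ, hψ⟩ := exists_complexFlow_openBox hD hf hf0 hudiff hK hKD hKa hz hza
    exact ⟨a, δ, hza, hδ, hψ⟩)
  refine ⟨fun z => (starRingEnd ℂ) (R z), hRdiff, fun z hz => ?_, fun z hz => ?_,
    fun z hz => ⟨R z, hRD z hz, ?_⟩, fun z hz => ?_, fun z hz => ?_⟩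
  · simp only [hR0 z (hΓD hz) (huΓ z hz)]
  · simpa using hRD z hz
  · simpa using hRR z hz
  · simpa using hRR z hz
  · simp [huR z hz]
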